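/- arXiv:1401.1388 — 2 statements merged into one kernel-verified Lean document; each statement's English description precedes it below -/
import Mathlib

section
/- Let Λ be a qubit channel with Kraus operators {Aᵢ}. If there exist a real number t > 0 and a maximally entangled unit vector ψ ∈ ℂ²⊗ℂ² with ρ_{Φ⁺,Λ} ψ = t·ψ, then Λ is unital, i.e. ∑ᵢ AᵢAᵢ† = 1. In particular, the Choi matrix of a nonunital qubit channel has no maximally entangled eigenvector with nonzero eigenvalue. -/
open Matrix
open scoped Kronecker

noncomputable section

/-- 2×2 complex matrices (single-qubit operators). -/
abbrev QMat := Matrix (Fin 2) (Fin 2) ℂ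

/-- 4×4 complex matrices indexed by `Fin 2 × Fin 2` (two-qubit operators). -/
abbrev TMat := Matrix (Fin 2 × Fin 2) (Fin 2 × Fin 2) ℂ

/-- Vectors in ℂ²⊗ℂ², indexed by `Fin 2 × Fin 2`. -/
abbrev TVec := (Fin 2 × Fin 2) → ℂ

/-- Outer product |ψ⟩⟨φ|. -/
def outer (ψ φ : TVec) : TMat := Matrix.vecMulVec ψ (star φ)

/-- The maximally entangled vector |Φ⁺⟩ = (|00⟩+|11⟩)/√2. -/
def phiPlus : TVec := fun p => if p.1 = p.2 then ((Real.sqrt 2 : ℂ))⁻¹ else 0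

/-- Action of id ⊗ Λ on two-qubit matrices, for a channel Λ with Kraus family `A`. -/
def channelOut {ι : Type*} [Fintype ι] (A : ι → QMat) (M : TMat) : TMat :=
  ∑ i, ((1 : QMat) ⊗ₖ A i) * M * ((1 : QMat) ⊗ₖ A i)ᴴ

/-- The Choi matrix ρ_{Φ⁺,Λ} = (id⊗Λ)(|Φ⁺⟩⟨Φ⁺|). -/
def choi {ι : Type*} [Fintype ι] (A : ι → QMat) : TMat :=
  channelOut A (outer phiPlus phiPlus)

/-- The Choi matrix of the dual channel: ρ_{Φ⁺,Λ̂} = ∑ᵢ (1⊗Aᵢᴴ)|Φ⁺⟩⟨Φ⁺|(1⊗Aᵢ). -/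
def choiDual {ι : Type*} [Fintype ι] (A : ι → QMat) : TMat :=
  channelOut (fun i => (A i)ᴴ) (outer phiPlus phiPlus)

/-- Kraus (trace-preserving) condition ∑ᵢ Aᵢᴴ Aᵢ = 1. -/
def IsKraus {ι : Type*} [Fintype ι] (A : ι → QMat) : Prop := ∑ i, (A i)ᴴ * A i = 1

/-- Partial trace over the second factor. -/
def ptraceB (M : TMat) : QMat := Matrix.of fun i j => ∑ k, M (i, k) (j, k)

/-- Unit vector: ⟨ψ|ψ⟩ = 1. -/
def IsUnitVec (ψ : TVec) : Prop := star ψ ⬝ᵥ ψ = 1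

/-- Maximally entangled vector: the partial trace of |ψ⟩⟨ψ| over the second
factor is (1/2)·1. -/
def MaxEnt (ψ : TVec) : Prop := ptraceB (outer ψ ψ) = (1/2 : ℂ) • 1

/-- Partial transpose on the first factor: M^Γ((i,k),(j,l)) = M((j,k),(i,l)). -/
def ptransp (M : TMat) : TMat := Matrix.of fun p q => M (q.1, p.2) (p.1, q.2)

open Classical in
/-- Largest eigenvalue of a Hermitian matrix (junk value 0 otherwise). -/
def lamMax {n : Type*} [Fintype n] [DecidableEq n] (M : Matrix n n ℂ) : ℝ :=
  if h : M.IsHermitian then ⨆ i, h.eigenvalues i else 0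

open Classical in
/-- Smallest eigenvalue of a Hermitian matrix (junk value 0 otherwise). -/
def lamMin {n : Type*} [Fintype n] [DecidableEq n] (M : Matrix n n ℂ) : ℝ :=
  if h : M.IsHermitian then ⨅ i, h.eigenvalues i else 0

/-- Negativity N(ρ) = max{0, −2 λ_min(ρ^Γ)}. -/
def negativity (M : TMat) : ℝ := max 0 (-2 * lamMin (ptransp M))

/-- The swap operator V on ℂ²⊗ℂ²: V(eᵢ⊗eⱼ) = eⱼ⊗eᵢ. -/
def swapM : TMat := Matrix.of fun p q => if p.1 = q.2 ∧ p.2 = q.1 then 1 else 0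

/-- The vector √λ|00⟩ + √(1−λ)|11⟩. -/
def xvec (l : ℝ) : TVec := fun p =>
  if p = (0, 0) then (Real.sqrt l : ℂ) else if p = (1, 1) then (Real.sqrt (1 - l) : ℂ) else 0

/-- Kraus operators of the amplitude damping channel with parameter p. -/
def adKraus (p : ℝ) : Fin 2 → QMat :=
  ![!![1, 0; 0, (Real.sqrt (1 - p) : ℂ)], !![0, (Real.sqrt p : ℂ); 0, 0]]

end

/-- Every 2×2 matrix satisfies `BᴴB + BBᴴ = conj(tr B) B + tr(B) Bᴴ + k 1` for a scalar `k`. -/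
lemma conjTranspose_mul_self_add_mul_conjTranspose (B : QMat) :
    Bᴴ * B + B * Bᴴ = star B.trace • B + B.trace • Bᴴ +
      ((Bᴴ * B).trace - B.trace * star B.trace) • (1 : QMat) := by
  ext i j
  fin_cases i <;> fin_cases j <;>
    simp [Matrix.mul_apply, Matrix.trace, Fin.sum_univ_two] <;> ring

/-- If `∑ᵢ conj(tr Bᵢ) Bᵢ` is scalar, the Kraus family `B` is unital. -/
lemma unital_of_sum_star_trace_smul {ι : Type*} [Fintype ι] (B : ι → QMat)
    (hB : IsKraus B) (c : ℂ) (hc : ∑ i, star (B i).trace • B i = c • (1 : QMat)) :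
    ∑ i, B i * (B i)ᴴ = 1 := by
  have hc' : ∑ i, (B i).trace • (B i)ᴴ = star c • (1 : QMat) := by
    have h := congrArg Matrix.conjTranspose hc
    rw [Matrix.conjTranspose_smul, Matrix.conjTranspose_one, Matrix.conjTranspose_sum] at h
    rw [← h]
    refine Finset.sum_congr rfl fun i _ => ?_
    rw [Matrix.conjTranspose_smul, star_star]
  have hsum := Finset.sum_congr (rfl : (Finset.univ : Finset ι) = Finset.univ)
    fun i _ => conjTranspose_mul_self_add_mul_conjTranspose (B i)
  unfold IsKraus at hB
  simp only [Finset.sum_add_distrib] at hsum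
  rw [hB, hc, hc', ← Finset.sum_smul, ← add_smul, ← add_smul] at hsum
  have htr : (∑ i, B i * (B i)ᴴ).trace = 2 := by
    have h := congrArg Matrix.trace hB
    rw [Matrix.trace_sum, Matrix.trace_one, Fintype.card_fin, Nat.cast_ofNat] at h
    rw [Matrix.trace_sum, ← h]
    exact Finset.sum_congr rfl fun i _ => Matrix.trace_mul_comm _ _
  set s := c + star c + ∑ i, (((B i)ᴴ * B i).trace - (B i).trace * star (B i).trace)
  have hs : s = 2 := by
    have h := congrArg Matrix.trace hsum
    rw [Matrix.trace_add, htr, Matrix.trace_smul, Matrix.trace_one, Fintype.card_fin,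
      smul_eq_mul] at h
    push_cast at h
    linear_combination -h / 2
  rw [hs, two_smul] at hsum
  exact add_left_cancel hsum

/-- The 2×2 matrix `W` with `ψ = (1 ⊗ W)|Φ⁺⟩`. -/
noncomputable def vecOperator (ψ : TVec) : QMat :=
  Matrix.of fun k i => (Real.sqrt 2 : ℂ) * ψ (i, k)

lemma ofReal_sqrt_two_mul_self : (Real.sqrt 2 : ℂ) * (Real.sqrt 2 : ℂ) = 2 := by
  exact_mod_cast Real.mul_self_sqrt zero_le_two

lemma MaxEnt.conjTranspose_mul_vecOperator {ψ : TVec} (h : MaxEnt ψ) :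
    (vecOperator ψ)ᴴ * vecOperator ψ = 1 := by
  ext i j
  have hij := congrFun (congrFun h j) i
  have h2 := ofReal_sqrt_two_mul_self
  simp only [ptraceB, outer, Matrix.of_apply, Matrix.vecMulVec_apply, Pi.star_apply,
    Matrix.smul_apply, smul_eq_mul, Fin.sum_univ_two] at hij
  simp only [Matrix.mul_apply, Fin.sum_univ_two, Matrix.conjTranspose_apply, vecOperator,
    Matrix.of_apply, star_mul', RCLike.star_def, Complex.conj_ofReal] at hij ⊢
  have hone : (1 : QMat) i j = (1 : QMat) j i := by simp [Matrix.one_apply, eq_comm]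
  rw [hone]
  linear_combination 2 * hij + (ψ (j, 0) * (starRingEnd ℂ) (ψ (i, 0)) +
    ψ (j, 1) * (starRingEnd ℂ) (ψ (i, 1))) * h2

lemma kronecker_mulVec_phiPlus (B : QMat) (i k : Fin 2) :
    (((1 : QMat) ⊗ₖ B) *ᵥ phiPlus) (i, k) = (Real.sqrt 2 : ℂ)⁻¹ * B k i := by
  fin_cases i <;>
    simp [Matrix.mulVec, dotProduct, Fintype.sum_prod_type, phiPlus, Fin.sum_univ_two, mul_comm]

lemma choi_apply {ι : Type*} [Fintype ι] (A : ι → QMat) (i k j l : Fin 2) :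
    choi A (i, k) (j, l) = (1 / 2) * ∑ n, A n k i * star (A n l j) := by
  have h2 : (Real.sqrt 2 : ℂ)⁻¹ * (Real.sqrt 2 : ℂ)⁻¹ = 1 / 2 := by
    rw [← mul_inv, ofReal_sqrt_two_mul_self, one_div]
  rw [choi, channelOut, Matrix.sum_apply, Finset.mul_sum]
  refine Finset.sum_congr rfl fun n _ => ?_
  rw [outer, Matrix.mul_vecMulVec, Matrix.vecMulVec_mul, ← Matrix.star_mulVec,
    Matrix.vecMulVec_apply, Pi.star_apply, kronecker_mulVec_phiPlus, kronecker_mulVec_phiPlus,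
    star_mul', star_inv₀, RCLike.star_def, Complex.conj_ofReal]
  linear_combination A n k i * (starRingEnd ℂ) (A n l j) * h2

lemma sum_trace_smul_of_choi_mulVec_eq {ι : Type*} [Fintype ι] (A : ι → QMat) (t : ℂ) (ψ : TVec)
    (h : choi A *ᵥ ψ = t • ψ) :
    ∑ n, star ((vecOperator ψ)ᴴ * A n).trace • A n = (2 * t) • vecOperator ψ := by
  ext k i
  have hik := congrFun h (i, k)
  simp only [Matrix.mulVec, dotProduct, Fintype.sum_prod_type, choi_apply, Fin.sum_univ_two,
    Pi.smul_apply, smul_eq_mul] at hik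
  rw [Matrix.smul_apply, smul_eq_mul, vecOperator, Matrix.of_apply,
    mul_left_comm (2 * t), mul_assoc 2 t, ← hik, Matrix.sum_apply]
  simp only [Finset.mul_sum, Finset.sum_mul, ← Finset.sum_add_distrib]
  refine Finset.sum_congr rfl fun n _ => ?_
  simp [Matrix.trace, Matrix.mul_apply, Fin.sum_univ_two]
  ring

/-- if the Choi matrix of a qubit channel has a maximally entangled unit
eigenvector with eigenvalue t > 0, then the channel is unital. -/
theorem stmt11 {ι : Type*} [Fintype ι] (A : ι → QMat) (hA : IsKraus A)
    (t : ℝ) (ht : 0 < t) (ψ : TVec) (hψu : IsUnitVec ψ) (hψme : MaxEnt ψ)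
    (heig : (choi A) *ᵥ ψ = (t : ℂ) • ψ) :
    ∑ i, A i * (A i)ᴴ = 1 := by
  set W := vecOperator ψ
  have hW : Wᴴ * W = 1 := hψme.conjTranspose_mul_vecOperator
  have hW' : W * Wᴴ = 1 := mul_eq_one_comm.mp hW
  have hB : IsKraus fun i => Wᴴ * A i := by
    unfold IsKraus
    rw [← hA]
    refine Finset.sum_congr rfl fun i _ => ?_
    rw [Matrix.conjTranspose_mul, Matrix.conjTranspose_conjTranspose, Matrix.mul_assoc,
      ← Matrix.mul_assoc W, hW', Matrix.one_mul]
  have hc : ∑ i, star (Wᴴ * A i).trace • (Wᴴ * A i) = (2 * (t : ℂ)) • (1 : QMat) := by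
    simp only [← Matrix.mul_smul]
    rw [← Matrix.mul_sum, sum_trace_smul_of_choi_mulVec_eq A t ψ heig, Matrix.mul_smul, hW]
  have hu := unital_of_sum_star_trace_smul _ hB _ hc
  have hconj : W * (∑ i, Wᴴ * A i * (Wᴴ * A i)ᴴ) * Wᴴ = ∑ i, A i * (A i)ᴴ := by
    rw [Matrix.mul_sum, Matrix.sum_mul]
    refine Finset.sum_congr rfl fun i _ => ?_
    calc W * (Wᴴ * A i * (Wᴴ * A i)ᴴ) * Wᴴ
        = (W * Wᴴ) * (A i * (A i)ᴴ) * (W * Wᴴ) := by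
          simp only [Matrix.conjTranspose_mul, Matrix.conjTranspose_conjTranspose,
            Matrix.mul_assoc]
      _ = A i * (A i)ᴴ := by rw [hW', Matrix.one_mul, Matrix.mul_one]
  rw [← hconj, hu, Matrix.mul_one, hW']
end

section
/- (Theorem 2.) Let Λ be a qubit channel with Kraus operators {Aᵢ}. Then ρ_{Φ⁺,Λ̂} admits a maximally entangled unit eigenvector corresponding to its largest eigenvalue if and only if Λ is unital, i.e. ∑ᵢ AᵢAᵢ† = 1. Equivalently, the optimal input state ψ₀ (an eigenvector for λ_max(ρ_{Φ⁺,Λ̂})) can be taken maximally entangled precisely when Λ is unital. -/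
open Matrix
open scoped Kronecker

/-- Entries of the dual Choi matrix in terms of the Kraus operators. -/
theorem choiDual_apply {ι : Type*} [Fintype ι] (A : ι → QMat) (p q : Fin 2 × Fin 2) :
    choiDual A p q = (1 / 2 : ℂ) * ∑ i, star (A i p.1 p.2) * A i q.1 q.2 := by
  have h2 : ((Real.sqrt 2 : ℂ))⁻¹ * ((Real.sqrt 2 : ℂ))⁻¹ = 1 / 2 := by
    rw [← mul_inv, ← Complex.ofReal_mul, Real.mul_self_sqrt (by norm_num)]
    norm_num
  obtain ⟨a, b⟩ := p
  obtain ⟨c, d⟩ := q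
  simp only [choiDual, channelOut, Matrix.sum_apply, Finset.mul_sum]
  refine Finset.sum_congr rfl fun i _ => ?_
  simp only [Matrix.mul_apply, Fintype.sum_prod_type, Fin.sum_univ_two, outer,
    vecMulVec_apply, phiPlus, kroneckerMap_apply, conjTranspose_apply, Pi.star_apply]
  rw [← h2]
  fin_cases a <;> fin_cases b <;> fin_cases c <;> fin_cases d <;> simp [Matrix.one_apply] <;> ring

theorem isHermitian_choiDual {ι : Type*} [Fintype ι] (A : ι → QMat) :
    (choiDual A).IsHermitian := by
  ext p q
  simp [choiDual_apply, mul_comm]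

/-- The dual Choi matrix acting on a vector, read as a `2 × 2` matrix. -/
theorem of_choiDual_mulVec {ι : Type*} [Fintype ι] (A : ι → QMat) (ψ : TVec) :
    (Matrix.of fun j k => (choiDual A *ᵥ ψ) (j, k) : QMat) =
      (1 / 2 : ℂ) • ∑ i, ((A i)ᵀ * Matrix.of fun j k => ψ (j, k)).trace • (A i)ᵀᴴ := by
  ext j k
  simp only [of_apply, mulVec, dotProduct, choiDual_apply, Fintype.sum_prod_type,
    Fin.sum_univ_two, Matrix.smul_apply, Matrix.sum_apply, smul_eq_mul, trace_fin_two,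
    Matrix.mul_apply, transpose_apply, conjTranspose_apply, mul_assoc, ← mul_add,
    Finset.sum_mul, ← Finset.sum_add_distrib]
  congr 1
  exact Finset.sum_congr rfl fun i _ => by ring

/-- The polarized Cayley–Hamilton identity for `2 × 2` matrices. -/
theorem mul_add_mul_eq_trace_fin_two {R : Type*} [CommRing R] (X Y : Matrix (Fin 2) (Fin 2) R) :
    X * Y + Y * X =
      X.trace • Y + Y.trace • X + ((X * Y).trace - X.trace * Y.trace) • 1 := by
  ext a b
  fin_cases a <;> fin_cases b <;>
    simp [Matrix.mul_apply, trace_fin_two, Fin.sum_univ_two] <;> ring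

theorem unital_of_maxEnt_eigenvector {ι : Type*} [Fintype ι] {A : ι → QMat} (hA : IsKraus A)
    {ψ : TVec} (hψ : MaxEnt ψ) {c : ℂ} (h : choiDual A *ᵥ ψ = c • ψ) :
    ∑ i, A i * (A i)ᴴ = 1 := by
  set X : QMat := Matrix.of fun j k => ψ (j, k) with hX
  have hXX : X * Xᴴ = (1 / 2 : ℂ) • 1 := by
    rw [← hψ]
    ext a b
    simp [hX, ptraceB, outer, vecMulVec_apply, Matrix.mul_apply]
  have hXX' : Xᴴ * X = (1 / 2 : ℂ) • 1 := by
    have h1 : X * ((2 : ℂ) • Xᴴ) = 1 := by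
      rw [Matrix.mul_smul, hXX, smul_smul]; norm_num
    have h2 := mul_eq_one_comm.mp h1
    rw [Matrix.smul_mul] at h2
    rw [← h2, smul_smul]; norm_num
  have heig : ∑ i, ((A i)ᵀ * X).trace • (A i)ᵀᴴ = (2 * c) • X := by
    have h1 := of_choiDual_mulVec A ψ
    rw [h] at h1
    have h2 : (Matrix.of fun j k => (c • ψ) (j, k) : QMat) = c • X := by
      ext; simp [hX]
    rw [h2] at h1
    rw [mul_smul, h1, smul_smul, mul_one_div_cancel two_ne_zero, one_smul]
  set B : ι → QMat := fun i => (A i)ᵀ * X with hB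
  have h1 : ∑ i, (B i).trace • (B i)ᴴ = c • 1 := by
    have : ∑ i, (B i).trace • (B i)ᴴ = Xᴴ * ∑ i, ((A i)ᵀ * X).trace • (A i)ᵀᴴ := by
      simp [hB, Matrix.mul_sum, conjTranspose_mul]
    rw [this, heig, Matrix.mul_smul, hXX', smul_smul]
    congr 1; ring
  have h2 : ∑ i, (B i)ᴴ.trace • B i = star c • 1 := by
    have := congrArg conjTranspose h1
    simpa [conjTranspose_sum, conjTranspose_smul, trace_conjTranspose] using this
  have h3 : ∑ i, B i * (B i)ᴴ = (1 / 2 : ℂ) • 1 := by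
    have hK : (∑ i, (A i)ᴴ * A i)ᵀ = 1 := by rw [hA, transpose_one]
    rw [← hK, transpose_sum, Finset.smul_sum]
    refine Finset.sum_congr rfl fun i _ => ?_
    rw [hB, conjTranspose_mul, Matrix.mul_assoc, ← Matrix.mul_assoc X, hXX, transpose_mul]
    simp
    rfl
  have h4 : ∑ i, (B i)ᴴ * B i = Xᴴ * (∑ i, A i * (A i)ᴴ)ᵀ * X := by
    rw [transpose_sum, Matrix.mul_sum, Matrix.sum_mul]
    refine Finset.sum_congr rfl fun i _ => ?_
    rw [hB, conjTranspose_mul, transpose_mul]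
    simp only [Matrix.mul_assoc]
    rfl
  obtain ⟨s, hs⟩ : ∃ s : ℂ, ∑ i, (B i)ᴴ * B i = s • 1 := by
    have h5 : ∑ i, (B i * (B i)ᴴ + (B i)ᴴ * B i) = _ :=
      Finset.sum_congr rfl fun i _ => mul_add_mul_eq_trace_fin_two (B i) (B i)ᴴ
    rw [Finset.sum_add_distrib, Finset.sum_add_distrib, Finset.sum_add_distrib, h1, h2, h3,
      ← Finset.sum_smul] at h5
    refine ⟨c + star c + (∑ i, ((B i * (B i)ᴴ).trace - (B i).trace * (B i)ᴴ.trace)) - 1 / 2, ?_⟩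
    rw [sub_smul, add_smul, add_smul, ← h5]
    abel
  have h6 : (∑ i, A i * (A i)ᴴ)ᵀ = (2 * s) • 1 := by
    have h7 : X * (Xᴴ * (∑ i, A i * (A i)ᴴ)ᵀ * X) * Xᴴ = X * (s • 1) * Xᴴ := by rw [← h4, hs]
    have h8 : X * (Xᴴ * (∑ i, A i * (A i)ᴴ)ᵀ * X) * Xᴴ =
        (X * Xᴴ) * (∑ i, A i * (A i)ᴴ)ᵀ * (X * Xᴴ) := by simp only [Matrix.mul_assoc]
    rw [h8, hXX] at h7
    simp only [Matrix.smul_mul, Matrix.mul_smul, Matrix.one_mul, Matrix.mul_one, hXX,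
      smul_smul] at h7
    have h9 := congrArg (fun M : QMat => (4 : ℂ) • M) h7
    simp only [smul_smul] at h9
    norm_num at h9
    rw [h9]; congr 1; ring
  have h10 : ∑ i, A i * (A i)ᴴ = (2 * s) • 1 := by
    have := congrArg transpose h6
    simpa using this
  have htr : (∑ i, A i * (A i)ᴴ).trace = 2 := by
    have : (∑ i, A i * (A i)ᴴ).trace = (∑ i, (A i)ᴴ * A i).trace := by
      simp only [trace_sum]
      exact Finset.sum_congr rfl fun i _ => trace_mul_comm _ _
    rw [this, hA]; simp
  rw [h10] at htr ⊢
  have hs1 : 2 * s = 1 := by simpa using htr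
  rw [hs1, one_smul]

/-- The spin flip `ψ ↦ -(σ_y ⊗ σ_y) ψ̄` on two qubits. -/
def spinFlip (ψ : TVec) : TVec := fun p =>
  (if p.1 = p.2 then 1 else -1) * star (ψ (1 - p.1, 1 - p.2))

theorem spinFlip_spinFlip (ψ : TVec) : spinFlip (spinFlip ψ) = ψ := by
  ext ⟨a, b⟩
  fin_cases a <;> fin_cases b <;> simp [spinFlip]

theorem spinFlip_add (ψ φ : TVec) : spinFlip (ψ + φ) = spinFlip ψ + spinFlip φ := by
  ext p
  simp [spinFlip, mul_add]

theorem spinFlip_smul (c : ℂ) (ψ : TVec) : spinFlip (c • ψ) = star c • spinFlip ψ := by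
  ext p
  simp only [spinFlip, Pi.smul_apply, smul_eq_mul, star_mul']
  ring

theorem choiDual_mulVec_spinFlip {ι : Type*} [Fintype ι] {A : ι → QMat} (hA : IsKraus A)
    (hU : ∑ i, A i * (A i)ᴴ = 1) (ψ : TVec) :
    choiDual A *ᵥ spinFlip ψ = spinFlip (choiDual A *ᵥ ψ) := by
  have hK : ∀ a b, choiDual A (0, a) (0, b) + choiDual A (1, a) (1, b) =
      if a = b then 1 / 2 else 0 := by
    intro a b
    have := congrFun (congrFun hA a) b
    simp only [Matrix.sum_apply, Matrix.mul_apply, conjTranspose_apply, Fin.sum_univ_two,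
      Finset.sum_add_distrib, Matrix.one_apply] at this
    rw [choiDual_apply, choiDual_apply, ← mul_add, this]
    split_ifs <;> simp
  have hV : ∀ a b, choiDual A (b, 0) (a, 0) + choiDual A (b, 1) (a, 1) =
      if a = b then 1 / 2 else 0 := by
    intro a b
    have := congrFun (congrFun hU a) b
    simp only [Matrix.sum_apply, Matrix.mul_apply, conjTranspose_apply, Fin.sum_univ_two,
      Finset.sum_add_distrib, Matrix.one_apply] at this
    simp only [mul_comm (A _ _ _)] at this
    rw [choiDual_apply, choiDual_apply, ← mul_add, this]
    split_ifs <;> simp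
  have hH : ∀ p q, star (choiDual A p q) = choiDual A q p :=
    fun p q => (isHermitian_choiDual A).apply q p
  have k01 := hK 0 1
  have k10 := hK 1 0
  have k11 := hK 1 1
  have v00 := hV 0 0
  have v01 := hV 0 1
  have v10 := hV 1 0
  have v11 := hV 1 1
  simp only [if_true, zero_ne_one, one_ne_zero, if_false] at k01 k10 k11 v00 v01 v10 v11
  ext ⟨a, b⟩
  fin_cases a <;> fin_cases b <;>
    simp only [spinFlip, mulVec, dotProduct, Fintype.sum_prod_type, Fin.sum_univ_two, star_add,
      star_mul', hH] <;> simp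
  · linear_combination (v00 - k11) * starRingEnd ℂ (ψ (1, 1)) - k01 * starRingEnd ℂ (ψ (1, 0)) -
      v10 * starRingEnd ℂ (ψ (0, 1))
  · linear_combination k10 * starRingEnd ℂ (ψ (1, 1)) - (k11 - v11) * starRingEnd ℂ (ψ (1, 0)) +
      v10 * starRingEnd ℂ (ψ (0, 0))
  · linear_combination v01 * starRingEnd ℂ (ψ (1, 1)) + (k11 - v11) * starRingEnd ℂ (ψ (0, 1)) +
      k01 * starRingEnd ℂ (ψ (0, 0))
  · linear_combination (k11 - v00) * starRingEnd ℂ (ψ (0, 0)) - v01 * starRingEnd ℂ (ψ (1, 0)) -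
      k10 * starRingEnd ℂ (ψ (0, 1))

theorem maxEnt_of_spinFlip_eq {ψ : TVec} (h : spinFlip ψ = ψ) (hψ : IsUnitVec ψ) : MaxEnt ψ := by
  have h11 : star (ψ (0, 0)) = ψ (1, 1) := by simpa [spinFlip] using congrFun h (1, 1)
  have h10 : -star (ψ (0, 1)) = ψ (1, 0) := by simpa [spinFlip] using congrFun h (1, 0)
  simp only [IsUnitVec, dotProduct, Fintype.sum_prod_type, Fin.sum_univ_two, Pi.star_apply,
    ← h11, ← h10, star_neg, star_star] at hψ
  ext a b
  fin_cases a <;> fin_cases b <;>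
    simp [ptraceB, outer, vecMulVec_apply, Fin.sum_univ_two, ← h11, ← h10] <;>
    simp at hψ <;> first | linear_combination hψ / 2 | ring

theorem exists_eigenvector_lamMax {n : Type*} [Fintype n] [DecidableEq n] [Nonempty n]
    {M : Matrix n n ℂ} (hM : M.IsHermitian) :
    ∃ v : n → ℂ, v ≠ 0 ∧ M *ᵥ v = (lamMax M : ℂ) • v := by
  obtain ⟨i, hi⟩ := exists_eq_ciSup_of_finite (f := hM.eigenvalues)
  refine ⟨hM.eigenvectorBasis i, ?_, ?_⟩
  · intro h
    exact hM.eigenvectorBasis.orthonormal.ne_zero i (by ext j; exact congrFun h j)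
  · rw [hM.mulVec_eigenvectorBasis, lamMax, dif_pos hM, ← hi]
    rfl

/-- A nonzero eigenspace for a real eigenvalue that is stable under the spin flip contains a
maximally entangled unit vector. -/
theorem exists_maxEnt_eigenvector {M : TMat}
    (hM : ∀ ψ, M *ᵥ spinFlip ψ = spinFlip (M *ᵥ ψ)) {l : ℝ} {v : TVec} (hv : v ≠ 0)
    (h : M *ᵥ v = (l : ℂ) • v) :
    ∃ ψ : TVec, IsUnitVec ψ ∧ MaxEnt ψ ∧ M *ᵥ ψ = (l : ℂ) • ψ := by
  have hf : M *ᵥ spinFlip v = (l : ℂ) • spinFlip v := by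
    rw [hM, h, spinFlip_smul]; simp
  obtain ⟨w, hw, hwf, hwe⟩ : ∃ w : TVec, w ≠ 0 ∧ spinFlip w = w ∧ M *ᵥ w = (l : ℂ) • w := by
    by_cases h0 : v + spinFlip v = 0
    · refine ⟨Complex.I • v, smul_ne_zero Complex.I_ne_zero hv, ?_, ?_⟩
      · rw [spinFlip_smul, ← neg_eq_of_add_eq_zero_right h0]; simp
      · rw [mulVec_smul, h, smul_comm]
    · refine ⟨v + spinFlip v, h0, ?_, ?_⟩
      · rw [spinFlip_add, spinFlip_spinFlip, add_comm]
      · rw [mulVec_add, h, hf, smul_add]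
  have hr : star w ⬝ᵥ w = ((∑ p, ‖w p‖ ^ 2 : ℝ) : ℂ) := by
    simp [dotProduct, Complex.conj_mul']
  have hpos : 0 < ∑ p, ‖w p‖ ^ 2 := by
    obtain ⟨p, hp⟩ := Function.ne_iff.mp hw
    exact Finset.sum_pos' (fun _ _ => by positivity)
      ⟨p, Finset.mem_univ _, by have := norm_pos_iff.mpr hp; positivity⟩
  set r : ℝ := ∑ p, ‖w p‖ ^ 2
  have hunit : IsUnitVec (((Real.sqrt r)⁻¹ : ℝ) • w) := by
    rw [IsUnitVec, star_smul, smul_dotProduct, dotProduct_smul, hr, smul_smul, star_trivial,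
      ← mul_inv, Real.mul_self_sqrt hpos.le, Complex.real_smul, ← Complex.ofReal_mul,
      inv_mul_cancel₀ hpos.ne', Complex.ofReal_one]
  refine ⟨_, hunit, maxEnt_of_spinFlip_eq ?_ hunit, ?_⟩
  · rw [← Complex.coe_smul, spinFlip_smul, hwf]; simp
  · rw [mulVec_smul, hwe, smul_comm]

/-- Theorem 2: ρ_{Φ⁺,Λ̂} admits a maximally entangled unit eigenvector for
its largest eigenvalue iff the channel is unital. -/
theorem stmt13 {ι : Type*} [Fintype ι] (A : ι → QMat) (hA : IsKraus A) :
    (∃ ψ : TVec, IsUnitVec ψ ∧ MaxEnt ψ ∧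
        (choiDual A) *ᵥ ψ = (lamMax (choiDual A) : ℂ) • ψ) ↔
      ∑ i, A i * (A i)ᴴ = 1 := by
  refine ⟨fun ⟨ψ, _, hψ, h⟩ => unital_of_maxEnt_eigenvector hA hψ h, fun hU => ?_⟩
  obtain ⟨v, hv, h⟩ := exists_eigenvector_lamMax (isHermitian_choiDual A)
  exact exists_maxEnt_eigenvector (choiDual_mulVec_spinFlip hA hU) hv h
end
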